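/- Under the Gaussian experiment setup, let î_n(x) be the smallest index i ∈ {1,…,K} maximizing m_{n,i}(x), and define the utilitarian regret R_n = θ_{I*} − ∫ θ_{î_n(x)} dP_n(x). Then the sequence n ↦ −(1/(K·n)) · ln(R_n) converges, as n → ∞, to Δ_min(θ)² / (4·K·σ²). In particular, a completely randomized trial with uniform allocation and empirical-best deployment achieves efficiency exponent Δ_min(θ)²/(4Kσ²). -/

import Mathlib

open MeasureTheory ProbabilityTheory Filter
open scoped Classical

/-- Empirical mean of arm `i` from `n` observations per arm. -/
noncomputable def mEmp (K n : ℕ) (x : Fin K → Fin n → ℝ) (i : Fin K) : ℝ :=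
  (1 / (n : ℝ)) * ∑ ℓ, x i ℓ

/-- The smallest index maximizing the empirical mean. -/
noncomputable def ihat (K n : ℕ) (hK : 0 < K) (x : Fin K → Fin n → ℝ) : Fin K :=
  (Finset.univ.filter (fun i => ∀ j, mEmp K n x j ≤ mEmp K n x i)).min' (by
    haveI : Nonempty (Fin K) := ⟨⟨0, hK⟩⟩
    obtain ⟨i, -, hi⟩ := Finset.exists_max_image (Finset.univ : Finset (Fin K))
      (mEmp K n x) Finset.univ_nonempty
    exact ⟨i, Finset.mem_filter.mpr ⟨Finset.mem_univ i, fun j => hi j (Finset.mem_univ j)⟩⟩)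

section Aux

open scoped NNReal

lemma aux_measurable_mEmp (K n : ℕ) (i : Fin K) : Measurable (fun x => mEmp K n x i) := by
  unfold mEmp
  fun_prop

lemma aux_ihat_mem (K n : ℕ) (hK : 0 < K) (x : Fin K → Fin n → ℝ) (j : Fin K) :
    mEmp K n x j ≤ mEmp K n x (ihat K n hK x) := by
  have h := Finset.min'_mem (Finset.univ.filter (fun i => ∀ j, mEmp K n x j ≤ mEmp K n x i)) (by
    haveI : Nonempty (Fin K) := ⟨⟨0, hK⟩⟩
    obtain ⟨i, -, hi⟩ := Finset.exists_max_image (Finset.univ : Finset (Fin K))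
      (mEmp K n x) Finset.univ_nonempty
    exact ⟨i, Finset.mem_filter.mpr ⟨Finset.mem_univ i, fun j => hi j (Finset.mem_univ j)⟩⟩)
  exact (Finset.mem_filter.mp h).2 j

lemma aux_ihat_le (K n : ℕ) (hK : 0 < K) (x : Fin K → Fin n → ℝ) (i : Fin K)
    (hi : ∀ j, mEmp K n x j ≤ mEmp K n x i) : ihat K n hK x ≤ i :=
  Finset.min'_le _ _ (Finset.mem_filter.mpr ⟨Finset.mem_univ i, hi⟩)

lemma aux_ihat_iff (K n : ℕ) (hK : 0 < K) (x : Fin K → Fin n → ℝ) (i : Fin K) :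
    ihat K n hK x = i ↔ (∀ j, mEmp K n x j ≤ mEmp K n x i) ∧
      ∀ k, (∀ j, mEmp K n x j ≤ mEmp K n x k) → i ≤ k := by
  constructor
  · rintro rfl
    exact ⟨aux_ihat_mem K n hK x, fun k hk => aux_ihat_le K n hK x k hk⟩
  · rintro ⟨h1, h2⟩
    exact le_antisymm (aux_ihat_le K n hK x i h1) (h2 _ (aux_ihat_mem K n hK x))

lemma aux_measurable_ihat (K n : ℕ) (hK : 0 < K) : Measurable (ihat K n hK) := by
  refine measurable_to_countable' fun i => ?_
  have : ihat K n hK ⁻¹' {i} = {x | (∀ j, mEmp K n x j ≤ mEmp K n x i) ∧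
      ∀ k, (∀ j, mEmp K n x j ≤ mEmp K n x k) → i ≤ k} := by
    ext x
    simp [aux_ihat_iff]
  rw [this]
  have hm := aux_measurable_mEmp K n
  have hS : ∀ k, MeasurableSet {x | ∀ j, mEmp K n x j ≤ mEmp K n x k} := fun k => by
    rw [Set.ofPred_forall]
    exact MeasurableSet.iInter fun j => measurableSet_le (hm j) (hm k)
  refine MeasurableSet.inter (hS i) ?_
  change MeasurableSet {x | ∀ k, (∀ j, mEmp K n x j ≤ mEmp K n x k) → i ≤ k}
  rw [Set.ofPred_forall]
  exact MeasurableSet.iInter fun k => MeasurableSet.imp (hS k) (MeasurableSet.const _)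

lemma aux_law (K n : ℕ) (hn : 0 < n) (w : ℝ≥0) (θ : Fin K → ℝ) (i j : Fin K) (hij : j ≠ i) :
    (Measure.pi (fun i : Fin K => Measure.pi (fun _ : Fin n => gaussianReal (θ i) w))).map
      (fun x => mEmp K n x j - mEmp K n x i) = gaussianReal (θ j - θ i) (2 * w / n) := by
  have hm := aux_measurable_mEmp K n
  have hD : Measurable (fun x => mEmp K n x j - mEmp K n x i) := (hm j).sub (hm i)
  haveI : IsProbabilityMeasure ((Measure.pi (fun i : Fin K => Measure.pi (fun _ : Fin n =>
    gaussianReal (θ i) w))).map (fun x => mEmp K n x j - mEmp K n x i)) :=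
    Measure.isProbabilityMeasure_map hD.aemeasurable
  apply Measure.ext_of_charFun
  ext t
  rw [charFun_gaussianReal, charFun_apply_real, integral_map hD.aemeasurable (by fun_prop)]
  set c : Fin K → ℝ := fun k => (if k = j then 1 else 0) - (if k = i then 1 else 0) with hc
  have h1 : ∀ x : Fin K → Fin n → ℝ,
      Complex.exp (t * ((mEmp K n x j - mEmp K n x i : ℝ) : ℂ) * Complex.I) =
      ∏ k, ∏ l, Complex.exp (((t * c k / n : ℝ) : ℂ) * (x k l : ℂ) * Complex.I) := by
    intro x
    simp_rw [← Complex.exp_sum]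
    congr 1
    simp_rw [← Finset.sum_mul, ← Finset.mul_sum]
    congr 1
    have : t * (mEmp K n x j - mEmp K n x i) = ∑ k, (t * c k / n) * ∑ l, x k l := by
      simp only [hc, mEmp, mul_sub, sub_mul, sub_div, Finset.sum_sub_distrib, mul_ite, ite_mul,
        mul_one, mul_zero, zero_mul, ite_div, zero_div, Finset.sum_ite_eq', Finset.mem_univ, if_true]
      ring
    exact_mod_cast this
  simp_rw [h1]
  rw [integral_fintype_prod_eq_prod (f := fun (k : Fin K) (y : Fin n → ℝ) =>
    ∏ l, Complex.exp (((t * c k / n : ℝ) : ℂ) * (y l : ℂ) * Complex.I))]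
  have h2 : ∀ k, ∫ y : Fin n → ℝ, ∏ l, Complex.exp (((t * c k / n : ℝ) : ℂ) * (y l : ℂ) * Complex.I)
      ∂(Measure.pi (fun _ : Fin n => gaussianReal (θ k) w)) =
      Complex.exp (c k * (t * θ k * Complex.I) - (c k)^2 * (w * t ^ 2 / 2 / n)) := by
    intro k
    rw [integral_fintype_prod_eq_prod (f := fun (_ : Fin n) (y : ℝ) =>
      Complex.exp (((t * c k / n : ℝ) : ℂ) * (y : ℂ) * Complex.I))]
    simp_rw [← charFun_apply_real, charFun_gaussianReal]
    rw [Finset.prod_const, Finset.card_univ, Fintype.card_fin, ← Complex.exp_nat_mul]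
    congr 1
    have : (n : ℂ) ≠ 0 := by exact_mod_cast hn.ne'
    push_cast
    field_simp
  simp_rw [h2]
  rw [← Complex.exp_sum]
  congr 1
  have hc2 : ∀ k, ((c k : ℝ) : ℂ)^2 = (if k = j then 1 else 0) + (if k = i then 1 else 0) := by
    intro k
    simp only [hc]
    by_cases h : k = j
    · subst h; simp [hij]
    · by_cases h' : k = i
      · subst h'; simp [Ne.symm hij]
      · simp [h, h']
  have hc1 : ∀ k, ((c k : ℝ) : ℂ) = (if k = j then 1 else 0) - (if k = i then 1 else 0) := by
    intro k
    simp only [hc]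
    split_ifs <;> simp
  simp_rw [hc2, hc1, Finset.sum_sub_distrib, sub_mul, add_mul, Finset.sum_sub_distrib,
    Finset.sum_add_distrib, ite_mul, one_mul, zero_mul, Finset.sum_ite_eq', Finset.mem_univ, if_true]
  push_cast
  ring

lemma aux_upper (d : ℝ) (hd : 0 ≤ d) (v : ℝ≥0) (hv : v ≠ 0) :
    (gaussianReal (-d) v).real (Set.Ici 0) ≤ Real.exp (-d ^ 2 / (2 * v)) := by
  have h := measure_ge_le_exp_mul_mgf (μ := gaussianReal (-d) v) (X := id) (t := d / v) 0
    (by positivity) (by simpa using integrable_exp_mul_gaussianReal (μ := -d) (v := v) (d / v))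
  rw [mgf_id_gaussianReal] at h
  have hv' : (v : ℝ) ≠ 0 := by exact_mod_cast hv
  refine h.trans (le_of_eq ?_)
  simp only [mul_zero, Real.exp_zero, one_mul]
  congr 1
  field_simp
  ring

lemma aux_lower (d : ℝ) (hd : 0 ≤ d) (v : ℝ≥0) (hv : v ≠ 0) (δ : ℝ) (hδ : 0 < δ) :
    δ * ((Real.sqrt (2 * Real.pi * v))⁻¹ * Real.exp (-(d + δ) ^ 2 / (2 * v))) ≤
    (gaussianReal (-d) v).real (Set.Ioi 0) := by
  have hle : (gaussianReal (-d) v).real (Set.Ioc 0 δ) ≤ (gaussianReal (-d) v).real (Set.Ioi 0) :=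
    measureReal_mono Set.Ioc_subset_Ioi_self
  refine le_trans ?_ hle
  rw [Measure.real, gaussianReal_apply_eq_integral _ hv, ENNReal.toReal_ofReal
    (integral_nonneg fun x => gaussianPDFReal_nonneg _ _ _)]
  have := setIntegral_ge_of_const_le_real (μ := volume) (s := Set.Ioc (0:ℝ) δ)
    (f := gaussianPDFReal (-d) v)
    (c := (Real.sqrt (2 * Real.pi * v))⁻¹ * Real.exp (-(d + δ) ^ 2 / (2 * v)))
    measurableSet_Ioc (by simp) (fun x hx => by
      rw [gaussianPDFReal]
      gcongr
      · have := hx.1; linarith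
      · have := hx.2; linarith) (integrable_gaussianPDFReal _ _).integrableOn
  simpa [Measure.real, hδ.le, mul_comm] using this

lemma aux_regret (K n : ℕ) (hK : 0 < K) (hn : 0 < n) (w : ℝ≥0) (hw : w ≠ 0) (θ : Fin K → ℝ)
    (i s : Fin K) (hs : s ≠ i) (d : ℝ) (hd : 0 < d) (hsd : θ i - θ s = d)
    (hmin : ∀ j, j ≠ i → d ≤ θ i - θ j) :
    d * ((1 / (n : ℝ)) * ((Real.sqrt (2 * Real.pi * (2 * w / n)))⁻¹ *
      Real.exp (-(d + 1 / n) ^ 2 / (2 * (2 * w / n))))) ≤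
      θ i - ∫ x, θ (ihat K n hK x) ∂(Measure.pi (fun i : Fin K => Measure.pi (fun _ : Fin n =>
            gaussianReal (θ i) w))) ∧
    θ i - ∫ x, θ (ihat K n hK x) ∂(Measure.pi (fun i : Fin K => Measure.pi (fun _ : Fin n =>
            gaussianReal (θ i) w))) ≤
      (∑ j ∈ Finset.univ.erase i, (θ i - θ j)) * Real.exp (-d ^ 2 / (2 * (2 * w / n))) := by
  set P := Measure.pi (fun i : Fin K => Measure.pi (fun _ : Fin n => gaussianReal (θ i) w)) with hP
  have hm := aux_measurable_mEmp K n
  have hD : ∀ j, Measurable (fun x => mEmp K n x j - mEmp K n x i) := fun j => (hm j).sub (hm i)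
  have hv : (2 * w / n : ℝ≥0) ≠ 0 := by
    have : (n : ℝ≥0) ≠ 0 := by exact_mod_cast hn.ne'
    positivity
  have hvc : ((2 * w / n : ℝ≥0) : ℝ) = 2 * w / n := by push_cast; rfl
  have hprob : ∀ j, j ≠ i → ∀ S : Set ℝ, MeasurableSet S →
      P.real ((fun x => mEmp K n x j - mEmp K n x i) ⁻¹' S) =
      (gaussianReal (-(θ i - θ j)) (2 * w / n)).real S := by
    intro j hj S hS
    rw [neg_sub, ← aux_law K n hn w θ i j hj, map_measureReal_apply (hD j) hS]
  have hint : Integrable (fun x => θ (ihat K n hK x)) P := by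
    obtain ⟨C, hC⟩ := (Set.finite_range (fun k => ‖θ k‖)).bddAbove
    refine Integrable.of_bound (C := C) ?_ ?_
    · exact ((measurable_of_finite θ).comp (aux_measurable_ihat K n hK)).aestronglyMeasurable
    · exact ae_of_all _ fun x => hC ⟨_, rfl⟩
  have hR : θ i - ∫ x, θ (ihat K n hK x) ∂P = ∫ x, (θ i - θ (ihat K n hK x)) ∂P := by
    rw [integral_sub (integrable_const _) hint]
    simp
  have hgint : Integrable (fun x => θ i - θ (ihat K n hK x)) P := (integrable_const _).sub hint
  have hnn : ∀ j, 0 ≤ θ i - θ j := by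
    intro j
    by_cases h : j = i
    · subst h; simp
    · exact hd.le.trans (hmin j h)
  rw [hR]
  constructor
  · have hE : MeasurableSet ((fun x => mEmp K n x s - mEmp K n x i) ⁻¹' Set.Ioi 0) :=
      hD s measurableSet_Ioi
    have h1 := aux_lower d hd.le (2 * w / n) hv (1 / (n : ℝ)) (by positivity)
    rw [← hsd, ← hprob s hs _ measurableSet_Ioi, hsd, hvc] at h1
    refine (mul_le_mul_of_nonneg_left h1 hd.le).trans ?_
    have h2 : d * P.real ((fun x => mEmp K n x s - mEmp K n x i) ⁻¹' Set.Ioi 0) =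
        ∫ x, ((fun x => mEmp K n x s - mEmp K n x i) ⁻¹' Set.Ioi 0).indicator (fun _ => d) x ∂P := by
      rw [integral_indicator_const _ hE, smul_eq_mul, mul_comm]
    rw [h2]
    refine integral_mono ((integrable_const d).indicator hE) hgint fun x => ?_
    refine Set.indicator_le' (fun x hx => ?_) (fun x _ => hnn _) x
    apply hmin
    intro h
    have h3 := aux_ihat_mem K n hK x s
    rw [h] at h3
    have h4 : 0 < mEmp K n x s - mEmp K n x i := hx
    linarith
  · have hE : ∀ j, MeasurableSet ((fun x => mEmp K n x j - mEmp K n x i) ⁻¹' Set.Ici 0) :=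
      fun j => hD j measurableSet_Ici
    have hint2 : ∀ j, Integrable (((fun x => mEmp K n x j - mEmp K n x i) ⁻¹' Set.Ici 0).indicator
        (fun _ => θ i - θ j)) P := fun j => (integrable_const _).indicator (hE j)
    calc ∫ x, (θ i - θ (ihat K n hK x)) ∂P
        ≤ ∫ x, ∑ j ∈ Finset.univ.erase i,
          ((fun x => mEmp K n x j - mEmp K n x i) ⁻¹' Set.Ici 0).indicator
            (fun _ => θ i - θ j) x ∂P := by
          refine integral_mono hgint (integrable_finsetSum _ fun j _ => hint2 j) fun x => ?_
          have hpos : ∀ j ∈ Finset.univ.erase i, 0 ≤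
            ((fun x => mEmp K n x j - mEmp K n x i) ⁻¹' Set.Ici 0).indicator
            (fun _ => θ i - θ j) x := fun j _ => Set.indicator_nonneg (fun _ _ => hnn j) x
          by_cases h : ihat K n hK x = i
          · simp only [h, sub_self]
            exact Finset.sum_nonneg hpos
          · refine le_trans (le_of_eq ?_) (Finset.single_le_sum hpos
              (Finset.mem_erase.mpr ⟨h, Finset.mem_univ _⟩))
            rw [Set.indicator_of_mem]
            exact sub_nonneg.mpr (aux_ihat_mem K n hK x i)
      _ = ∑ j ∈ Finset.univ.erase i, (θ i - θ j) *
          P.real ((fun x => mEmp K n x j - mEmp K n x i) ⁻¹' Set.Ici 0) := by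
          rw [integral_finsetSum _ fun j _ => hint2 j]
          refine Finset.sum_congr rfl fun j _ => ?_
          rw [integral_indicator_const _ (hE j), smul_eq_mul, mul_comm]
      _ ≤ _ := by
          rw [Finset.sum_mul]
          refine Finset.sum_le_sum fun j hj => mul_le_mul_of_nonneg_left ?_ (hnn j)
          have hj' := Finset.ne_of_mem_erase hj
          rw [hprob j hj' _ measurableSet_Ici]
          refine (aux_upper _ (hnn j) _ hv).trans ?_
          rw [hvc]
          have := hmin j hj'
          gcongr

lemma aux_main (K : ℕ) (hK : 0 < K) (w : ℝ≥0) (hw : w ≠ 0) (θ : Fin K → ℝ)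
    (i s : Fin K) (hs : s ≠ i) (d : ℝ) (hd : 0 < d) (hsd : θ i - θ s = d)
    (hmin : ∀ j, j ≠ i → d ≤ θ i - θ j) :
    Tendsto (fun n : ℕ => -(1 / ((K : ℝ) * n)) * Real.log
        (θ i - ∫ x, θ (ihat K n hK x) ∂(Measure.pi (fun i : Fin K => Measure.pi (fun _ : Fin n =>
            gaussianReal (θ i) w))))) atTop (nhds (d ^ 2 / (4 * K * w))) := by
  have hK' : (0 : ℝ) < K := by exact_mod_cast hK
  have hw' : (0 : ℝ) < w := by exact_mod_cast pos_iff_ne_zero.mpr hw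
  set C := ∑ j ∈ Finset.univ.erase i, (θ i - θ j) with hC
  have hCpos : 0 < C := Finset.sum_pos (fun j hj => hd.trans_le (hmin j (Finset.ne_of_mem_erase hj)))
    ⟨s, Finset.mem_erase.mpr ⟨hs, Finset.mem_univ _⟩⟩
  have hinv : Tendsto (fun n : ℕ => 1 / (n : ℝ)) atTop (nhds 0) := tendsto_one_div_atTop_nhds_zero_nat
  have hlog : Tendsto (fun n : ℕ => Real.log n / (n : ℝ)) atTop (nhds 0) :=
    (Real.isLittleO_log_id_atTop.tendsto_div_nhds_zero).comp tendsto_natCast_atTop_atTop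
  have hA : Tendsto (fun n : ℕ => -(1 / (K : ℝ)) * (Real.log C * (1 / (n : ℝ)) - d ^ 2 / (4 * w)))
      atTop (nhds (d ^ 2 / (4 * K * w))) := by
    have := ((hinv.const_mul (Real.log C)).sub_const (d ^ 2 / (4 * w))).const_mul (-(1 / (K : ℝ)))
    convert this using 2
    field_simp
    ring
  have hB : Tendsto (fun n : ℕ => -(1 / (K : ℝ)) *
      ((Real.log d - Real.log (4 * Real.pi * w) / 2) * (1 / (n : ℝ)) - (1 / 2) * (Real.log n / n)
        - (d + 1 / n) ^ 2 / (4 * w)))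
      atTop (nhds (d ^ 2 / (4 * K * w))) := by
    have := ((((hinv.const_mul (Real.log d - Real.log (4 * Real.pi * w) / 2)).sub
      (hlog.const_mul (1 / 2))).sub (((hinv.const_add d).pow 2).div_const (4 * (w : ℝ)))).const_mul
        (-(1 / (K : ℝ))))
    convert this using 2
    field_simp
    ring
  refine tendsto_of_tendsto_of_tendsto_of_le_of_le' hA hB ?_ ?_
  all_goals
    filter_upwards [eventually_gt_atTop 0] with n hn
    have hn' : (0 : ℝ) < n := by exact_mod_cast hn
    obtain ⟨h1, h2⟩ := aux_regret K n hK hn w hw θ i s hs d hd hsd hmin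
    have hlo : 0 < d * ((1 / (n : ℝ)) * ((Real.sqrt (2 * Real.pi * (2 * w / n)))⁻¹ *
      Real.exp (-(d + 1 / n) ^ 2 / (2 * (2 * w / n))))) := by positivity
  · have h3 := Real.log_le_log (hlo.trans_le h1) h2
    rw [Real.log_mul hCpos.ne' (Real.exp_pos _).ne', Real.log_exp] at h3
    have h4 := mul_le_mul_of_nonpos_left h3 (show -(1 / ((K : ℝ) * n)) ≤ 0 by
      have : 0 < 1 / ((K : ℝ) * n) := by positivity
      linarith)
    refine le_trans (le_of_eq ?_) h4
    field_simp
    ring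
  · have h3 := Real.log_le_log hlo h1
    have hsq : Real.sqrt (2 * Real.pi * (2 * w / n)) ≠ 0 := by positivity
    rw [Real.log_mul hd.ne' (by positivity), Real.log_mul (by positivity) (by positivity),
      Real.log_mul (by positivity) (by positivity), Real.log_exp, Real.log_inv,
      Real.log_sqrt (by positivity),
      show 2 * Real.pi * (2 * (w : ℝ) / n) = (4 * Real.pi * w) / n by ring,
      Real.log_div one_ne_zero hn'.ne', Real.log_div (by positivity) hn'.ne', Real.log_one] at h3
    have h4 := mul_le_mul_of_nonpos_left h3 (show -(1 / ((K : ℝ) * n)) ≤ 0 by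
      have : 0 < 1 / ((K : ℝ) * n) := by positivity
      linarith)
    refine le_trans h4 (le_of_eq ?_)
    field_simp
    ring

end Aux

/-- Under the Gaussian experiment setup, the utilitarian regret of the completely
randomized trial with uniform allocation and empirical-best deployment has large-deviation rate
(efficiency exponent) `Δ_min(θ)²/(4Kσ²)` in the total sample size `K·n`. -/
theorem stmt_3 (K : ℕ) (hK : 2 ≤ K) (σ : ℝ) (hσ : 0 < σ) (θ : Fin K → ℝ) (Istar : Fin K)
    (hmax : ∀ j, j ≠ Istar → θ j < θ Istar) :
    Tendsto (fun n : ℕ =>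
      -(1 / ((K : ℝ) * n)) * Real.log
        (θ Istar - ∫ x, θ (ihat K n (by omega) x)
          ∂(Measure.pi (fun i : Fin K => Measure.pi (fun _ : Fin n =>
            gaussianReal (θ i) ⟨σ ^ 2, sq_nonneg σ⟩)))))
      atTop
      (nhds ((θ Istar - ⨆ j : {j : Fin K // j ≠ Istar}, θ j.1) ^ 2 / (4 * K * σ ^ 2))) := by
  have hne : ∃ j : Fin K, j ≠ Istar := by
    haveI : Nontrivial (Fin K) := Fin.nontrivial_iff_two_le.mpr hK
    exact exists_ne Istar
  haveI : Nonempty {j : Fin K // j ≠ Istar} := ⟨⟨hne.choose, hne.choose_spec⟩⟩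
  obtain ⟨s, hs⟩ := exists_eq_ciSup_of_finite (f := fun j : {j : Fin K // j ≠ Istar} => θ j.1)
  have hbdd : BddAbove (Set.range fun j : {j : Fin K // j ≠ Istar} => θ j.1) :=
    (Set.finite_range _).bddAbove
  have hw : (⟨σ ^ 2, sq_nonneg σ⟩ : NNReal) ≠ 0 := by
    intro h
    have h' := congrArg NNReal.toReal h
    have : σ ^ 2 = 0 := h'
    exact (pow_pos hσ 2).ne' this
  have h := aux_main K (by omega) ⟨σ ^ 2, sq_nonneg σ⟩ hw θ Istar s.1 s.2
    (θ Istar - ⨆ j : {j : Fin K // j ≠ Istar}, θ j.1)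
    (by rw [← hs]; exact sub_pos.mpr (hmax _ s.2)) (by rw [← hs])
    (fun j hj => sub_le_sub_left (le_ciSup hbdd ⟨j, hj⟩) _)
  exact h
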